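/- Pull-back of a Hamiltonian-dissipative vector field with translation by a symplectic transformation (Lemma 5.4). Let η ∈ ℝ, ξ, ζ ∈ ℝⁿ, let φ : ℝⁿ → ℝⁿ be a C² diffeomorphism, S : ℝⁿ → ℝ of class C², and H : ℝⁿ×ℝⁿ → ℝ of class C². Define g(θ,r) = (φ(θ), (Dφ(θ)ᵀ)⁻¹·(r + ∇S(θ) + ξ)) and the vector field v(θ,r) = (∇_r H(θ,r), −∇_θ H(θ,r) − η(r − ζ)). Then the pull-back g*v := (Dg)⁻¹·(v∘g) is given, at every point (θ,r), by g*v(θ,r) = (∇_r Ĥ(θ,r), −∇_θ Ĥ(θ,r) − η(r − ζ̂)), where ζ̂ = ζ − ξ and Ĥ(θ,r) = H(g(θ,r)) + η·(S(θ) − ζ·(φ(θ) − θ)). -/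

import Mathlib

open scoped RealInnerProductSpace

section

variable {E : Type*} [NormedAddCommGroup E] [InnerProductSpace ℝ E]

/-- Derivative of the relation `Dφ(θ)ᵀ R(θ,r) = r + ∇S(θ) + ξ`, tested against a vector `c`. -/
theorem inner_fderiv_of_inner_fderiv_eq {φ : E → E} {S : E → ℝ} (hφ : ContDiff ℝ 2 φ)
    (hS : ContDiff ℝ 2 S) {R : E × E → E} {ξ : E} {p : E × E} (hR : DifferentiableAt ℝ R p)
    (h : ∀ q c, ⟪R q, fderiv ℝ φ q.1 c⟫ = ⟪q.2 + ξ, c⟫ + fderiv ℝ S q.1 c) (x y c : E) :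
    ⟪fderiv ℝ R p (x, y), fderiv ℝ φ p.1 c⟫ + ⟪R p, fderiv ℝ (fderiv ℝ φ) p.1 x c⟫ =
      ⟪y, c⟫ + fderiv ℝ (fderiv ℝ S) p.1 x c := by
  have dφ : HasFDerivAt (fderiv ℝ φ) _ p.1 :=
    ((hφ.fderiv_right (m := 1) (by norm_num)).differentiable (by norm_num) p.1).hasFDerivAt
  have dS : HasFDerivAt (fderiv ℝ S) _ p.1 :=
    ((hS.fderiv_right (m := 1) (by norm_num)).differentiable (by norm_num) p.1).hasFDerivAt
  have fst : HasFDerivAt (Prod.fst : E × E → E) (.fst ℝ E E) p := hasFDerivAt_fst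
  have snd : HasFDerivAt (Prod.snd : E × E → E) (.snd ℝ E E) p := hasFDerivAt_snd
  have h1 := hR.hasFDerivAt.inner ℝ ((dφ.comp p fst).clm_apply (hasFDerivAt_const c p))
  have h2 := ((snd.add_const ξ).inner ℝ (hasFDerivAt_const c p)).add
    ((dS.comp p fst).clm_apply (hasFDerivAt_const c p))
  have h3 := h1.unique (h2.congr_of_eventuallyEq (Filter.Eventually.of_forall fun q => h q c))
  simpa [add_comm] using DFunLike.congr_fun h3 (x, y)

variable [CompleteSpace E]

theorem inner_gradient_eq_fderiv (f : E → ℝ) (x c : E) : ⟪gradient f x, c⟫ = fderiv ℝ f x c := by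
  simp [gradient]

theorem inner_gradient_prodMk_right {F : Type*} [NormedAddCommGroup F] [NormedSpace ℝ F]
    {f : F × E → ℝ} {p : F × E} (hf : DifferentiableAt ℝ f p) (c : E) :
    ⟪gradient (fun r => f (p.1, r)) p.2, c⟫ = fderiv ℝ f p (0, c) := by
  have h : HasFDerivAt (fun r => f (p.1, r)) _ p.2 :=
    HasFDerivAt.comp p.2 (hf.hasFDerivAt : HasFDerivAt f _ (p.1, p.2))
      (hasFDerivAt_prodMk_right p.1 p.2)
  rw [inner_gradient_eq_fderiv, h.fderiv]
  simp

theorem inner_gradient_prodMk_left {F : Type*} [NormedAddCommGroup F] [NormedSpace ℝ F]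
    {f : E × F → ℝ} {p : E × F} (hf : DifferentiableAt ℝ f p) (c : E) :
    ⟪gradient (fun x => f (x, p.2)) p.1, c⟫ = fderiv ℝ f p (c, 0) := by
  have h : HasFDerivAt (fun x => f (x, p.2)) _ p.1 :=
    HasFDerivAt.comp p.1 (hf.hasFDerivAt : HasFDerivAt f _ (p.1, p.2))
      (hasFDerivAt_prodMk_left p.1 p.2)
  rw [inner_gradient_eq_fderiv, h.fderiv]
  simp

theorem ContDiff.differentiable_gradient {f : E → ℝ} (hf : ContDiff ℝ 2 f) :
    Differentiable ℝ (gradient f) := by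
  have h : Differentiable ℝ (fderiv ℝ f) :=
    (hf.fderiv_right (m := 1) (by norm_num)).differentiable (by norm_num)
  exact fun x => (InnerProductSpace.toDual ℝ E).symm.toContinuousLinearEquiv.differentiableAt.comp
    x (h x)

end

/-- **Lemma 5.4** (pull-back of a Hamiltonian-dissipative vector field with translation
by a symplectic transformation).  With
`g(θ,r) = (φ(θ), (Dφ(θ)ᵀ)⁻¹(r + ∇S(θ) + ξ))` and
`v(θ,r) = (∇_r H, −∇_θ H − η(r − ζ))`, the pull-back `g*v = (Dg)⁻¹(v∘g)` equals
`(∇_r Ĥ, −∇_θ Ĥ − η(r − ζ̂))` with `ζ̂ = ζ − ξ` and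
`Ĥ(θ,r) = H(g(θ,r)) + η (S(θ) − ζ·(φ(θ) − θ))`.  Here `A θ` is the inverse of the
transposed Jacobian `Dφ(θ)ᵀ` (the adjoint of `fderiv ℝ φ θ`), and
`(fderiv ℝ G p).inverse` is the inverse of the Jacobian of `g`. -/
theorem pullback_hamiltonian_dissipative_translated (n : ℕ) (η : ℝ)
    (ξ ζ : EuclideanSpace ℝ (Fin n))
    (φv ψv : EuclideanSpace ℝ (Fin n) → EuclideanSpace ℝ (Fin n))
    (hφ : ContDiff ℝ 2 φv) (hψ : ContDiff ℝ 2 ψv)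
    (hlr : Function.LeftInverse ψv φv) (hrl : Function.RightInverse ψv φv)
    (S : EuclideanSpace ℝ (Fin n) → ℝ) (hS : ContDiff ℝ 2 S)
    (H : EuclideanSpace ℝ (Fin n) × EuclideanSpace ℝ (Fin n) → ℝ) (hH : ContDiff ℝ 2 H)
    (A : EuclideanSpace ℝ (Fin n) → EuclideanSpace ℝ (Fin n) →L[ℝ] EuclideanSpace ℝ (Fin n))
    (hA₁ : ∀ θ, (A θ).comp (ContinuousLinearMap.adjoint (fderiv ℝ φv θ)) =
      ContinuousLinearMap.id ℝ (EuclideanSpace ℝ (Fin n)))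
    (hA₂ : ∀ θ, (ContinuousLinearMap.adjoint (fderiv ℝ φv θ)).comp (A θ) =
      ContinuousLinearMap.id ℝ (EuclideanSpace ℝ (Fin n)))
    (G V : EuclideanSpace ℝ (Fin n) × EuclideanSpace ℝ (Fin n) →
      EuclideanSpace ℝ (Fin n) × EuclideanSpace ℝ (Fin n))
    (hG : G = fun p => (φv p.1, A p.1 (p.2 + gradient S p.1 + ξ)))
    (hV : V = fun p => (gradient (fun r => H (p.1, r)) p.2,
      -gradient (fun θ => H (θ, p.2)) p.1 - η • (p.2 - ζ)))
    (Hhat : EuclideanSpace ℝ (Fin n) × EuclideanSpace ℝ (Fin n) → ℝ)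
    (hHhat : Hhat = fun p =>
      H (G p) + η * (S p.1 - ⟪ζ, φv p.1 - p.1⟫)) :
    ∀ p : EuclideanSpace ℝ (Fin n) × EuclideanSpace ℝ (Fin n),
      (fderiv ℝ G p).inverse (V (G p)) =
        (gradient (fun r => Hhat (p.1, r)) p.2,
          -gradient (fun θ => Hhat (θ, p.2)) p.1 - η • (p.2 - (ζ - ξ))) := by
  intro p
  have dφ := hφ.differentiable (by norm_num)
  have dψ := hψ.differentiable (by norm_num)
  have dS := hS.differentiable (by norm_num)
  have dH := hH.differentiable (by norm_num)
  have hCB (θ) : (fderiv ℝ ψv (φv θ)).comp (fderiv ℝ φv θ) = .id ℝ _ := by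
    rw [← fderiv_comp θ (dψ _) (dφ _), hlr.comp_eq_id, fderiv_id]
  have hBC (θ) : (fderiv ℝ φv θ).comp (fderiv ℝ ψv (φv θ)) = .id ℝ _ := by
    have h := fderiv_comp (φv θ) (dφ (ψv (φv θ))) (dψ (φv θ))
    rwa [hrl.comp_eq_id, fderiv_id, hlr θ, eq_comm] at h
  have hA : A = fun θ => ContinuousLinearMap.adjoint (fderiv ℝ ψv (φv θ)) := by
    funext θ
    have h : (ContinuousLinearMap.adjoint (fderiv ℝ φv θ)).comp
        (ContinuousLinearMap.adjoint (fderiv ℝ ψv (φv θ))) = .id ℝ _ := by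
      rw [← ContinuousLinearMap.adjoint_comp, hCB, ContinuousLinearMap.adjoint_id]
    calc A θ = (A θ).comp ((ContinuousLinearMap.adjoint (fderiv ℝ φv θ)).comp
        (ContinuousLinearMap.adjoint (fderiv ℝ ψv (φv θ)))) := by rw [h, ContinuousLinearMap.comp_id]
      _ = _ := by rw [← ContinuousLinearMap.comp_assoc, hA₁, ContinuousLinearMap.id_comp]
  have dA : Differentiable ℝ A := by
    have h : Differentiable ℝ (fderiv ℝ ψv) :=
      (hψ.fderiv_right (m := 1) (by norm_num)).differentiable (by norm_num)
    rw [hA]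
    exact fun θ => (ContinuousLinearMap.adjoint (𝕜 := ℝ)
      (E := EuclideanSpace ℝ (Fin n))
      (F := EuclideanSpace ℝ (Fin n))).toContinuousLinearEquiv.differentiableAt.comp θ
        ((h _).comp θ (dφ θ))
  have dgS := hS.differentiable_gradient
  set R : EuclideanSpace ℝ (Fin n) × EuclideanSpace ℝ (Fin n) → EuclideanSpace ℝ (Fin n) :=
    fun q => A q.1 (q.2 + gradient S q.1 + ξ) with hR
  have dR : Differentiable ℝ R := by
    have h : Differentiable ℝ fun q : EuclideanSpace ℝ (Fin n) × EuclideanSpace ℝ (Fin n) =>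
        A q.1 := dA.comp differentiable_fst
    exact h.clm_apply
      ((differentiable_snd.add (dgS.comp differentiable_fst)).add_const ξ)
  have inner_R (q c) : ⟪R q, fderiv ℝ φv q.1 c⟫ = ⟪q.2 + ξ, c⟫ + fderiv ℝ S q.1 c := by
    rw [← ContinuousLinearMap.adjoint_inner_left, hR, ← ContinuousLinearMap.comp_apply, hA₂,
      ← inner_gradient_eq_fderiv, ← inner_add_left, ContinuousLinearMap.id_apply, add_right_comm]
  have key := inner_fderiv_of_inner_fderiv_eq hφ hS (dR p) inner_R
  have hGp : HasFDerivAt G (((fderiv ℝ φv p.1).comp (.fst ℝ _ _)).prod (fderiv ℝ R p)) p := by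
    rw [hG]
    exact ((dφ p.1).hasFDerivAt.comp p hasFDerivAt_fst).prodMk (dR p).hasFDerivAt
  have hG_apply (x y) : fderiv ℝ G p (x, y) = (fderiv ℝ φv p.1 x, fderiv ℝ R p (x, y)) := by
    rw [hGp.fderiv]; rfl
  have fst : HasFDerivAt Prod.fst
      (.fst ℝ (EuclideanSpace ℝ (Fin n)) (EuclideanSpace ℝ (Fin n))) p := hasFDerivAt_fst
  have hHhat_p := ((dH (G p)).hasFDerivAt.comp p hGp).add
    ((((dS p.1).hasFDerivAt.comp p fst).sub
      ((hasFDerivAt_const ζ p).inner ℝ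
        (((dφ p.1).hasFDerivAt.comp p fst).sub fst))).const_mul η)
  replace hHhat_p := hHhat_p.congr_of_eventuallyEq
    (Filter.Eventually.of_forall fun q => congrFun hHhat q)
  set P := gradient (fun θ => H (θ, (G p).2)) (G p).1 with hP
  set Q := gradient (fun r => H ((G p).1, r)) (G p).2 with hQ
  have hH_apply (x y) : fderiv ℝ H (G p) (x, y) = ⟪P, x⟫ + ⟪Q, y⟫ := by
    rw [hP, hQ, inner_gradient_prodMk_left (dH _), inner_gradient_prodMk_right (dH _), ← map_add]
    simp
  have hHhat_apply (x y) : fderiv ℝ Hhat p (x, y) = ⟪P, fderiv ℝ φv p.1 x⟫ +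
      ⟪Q, fderiv ℝ R p (x, y)⟫ + η * (fderiv ℝ S p.1 x - ⟪ζ, fderiv ℝ φv p.1 x - x⟫) := by
    rw [hHhat_p.fderiv, ← hH_apply]
    simp
  have grad_r := inner_gradient_prodMk_right hHhat_p.differentiableAt
  have grad_θ := inner_gradient_prodMk_left hHhat_p.differentiableAt
  set a := gradient (fun r => Hhat (p.1, r)) p.2
  set t := gradient (fun θ => Hhat (θ, p.2)) p.1
  have hBC_apply (x) : fderiv ℝ φv p.1 (fderiv ℝ ψv (φv p.1) x) = x :=
    DFunLike.congr_fun (hBC p.1) x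
  have ha : fderiv ℝ φv p.1 a = Q := by
    have h : a = fderiv ℝ ψv (φv p.1) Q := by
      refine ext_inner_right ℝ fun c => ?_
      have h := key 0 c (fderiv ℝ ψv (φv p.1) Q)
      rw [hBC_apply] at h
      rw [grad_r, hHhat_apply, real_inner_comm c]
      simpa [real_inner_comm] using h
    rw [h, hBC_apply]
  have hφ_symm (x y) : fderiv ℝ (fderiv ℝ φv) p.1 x y = fderiv ℝ (fderiv ℝ φv) p.1 y x :=
    hφ.contDiffAt.isSymmSndFDerivAt (by simp) x y
  have hS_symm (x y) : fderiv ℝ (fderiv ℝ S) p.1 x y = fderiv ℝ (fderiv ℝ S) p.1 y x :=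
    hS.contDiffAt.isSymmSndFDerivAt (by simp) x y
  have h_snd : fderiv ℝ R p (a, -t - η • (p.2 - (ζ - ξ))) = -P - η • (R p - ζ) := by
    refine ext_inner_right ℝ fun c' => ?_
    obtain ⟨c, rfl⟩ : ∃ c, fderiv ℝ φv p.1 c = c' := ⟨_, hBC_apply c'⟩
    have h1 := key a (-t - η • (p.2 - (ζ - ξ))) c
    have h2 := key c 0 a
    have h3 := grad_θ c
    have h4 := inner_R p c
    rw [hHhat_apply] at h3
    rw [ha, real_inner_comm, hφ_symm, hS_symm] at h2
    simp only [inner_sub_left, inner_sub_right, inner_add_left, inner_neg_left,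
      real_inner_smul_left, inner_zero_left] at h1 h2 h3 h4 ⊢
    linear_combination h1 - h2 - h3 + η * h4
  have h_fderiv : fderiv ℝ G p (a, -t - η • (p.2 - (ζ - ξ))) = V (G p) := by
    rw [hG_apply, ha, h_snd, hV, hQ, hP, hG]
  have h_inj : Function.Injective (fderiv ℝ G p) := by
    rw [injective_iff_map_eq_zero]
    rintro ⟨x, y⟩ h
    rw [hG_apply, Prod.mk_eq_zero] at h
    have hx : x = 0 := by
      have := DFunLike.congr_fun (hCB p.1) x
      simpa [h.1, eq_comm] using this
    subst hx
    refine Prod.mk_eq_zero.2 ⟨rfl, ext_inner_right ℝ fun c => ?_⟩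
    have := key 0 y c
    simpa [h.2, eq_comm] using this
  let e := (LinearEquiv.ofInjectiveEndo (fderiv ℝ G p).toLinearMap h_inj).toContinuousLinearEquiv
  have he : fderiv ℝ G p = e := ContinuousLinearMap.ext fun _ => rfl
  rw [← h_fderiv, he, ContinuousLinearMap.inverse_equiv]
  exact e.symm_apply_apply _
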